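/- arXiv:1004.1360 — 4 statements merged into one kernel-verified Lean document; each statement's English description precedes it below -/
import Mathlib

section
/- For every integer m ≥ 3 there exist a nonempty open interval I ⊆ ℝ and a continuous family (j(t))_{t∈I} of real-linear maps from ℝ² to su(m) such that: (i) the maps are pairwise isospectral, i.e., for all s,t ∈ I and every Z ∈ ℝ² there exists A ∈ SU(m) with j(t)_Z = A·j(s)_Z·A⁻¹; (ii) for s ≠ t the maps j(s) and j(t) are not equivalent, i.e., there exist no matrix map A : ℂ^m → ℂ^m that is either given by a matrix in SU(m) or of the form B·Q with B ∈ SU(m) and Q the entrywise complex conjugation of ℂ^m, and no Ψ ∈ E, such that j(t)_Z = A ∘ j(s)_{Ψ(Z)} ∘ A⁻¹ for all Z ∈ ℝ²; (iii) each j(t) is generic, i.e., no nonzero element of su(m) commutes with both j(t)_{Z₁} and j(t)_{Z₂}. -/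
open Matrix

namespace IsospectralPencil

/-- A vector of `ℂ²` placed in the row `none` of an otherwise zero matrix. -/
def coupling (k : ℕ) (w : Fin 2 → ℂ) : Matrix (Option (Fin k)) (Fin 2) ℂ :=
  fun i c => i.elim (w c) fun _ => 0

/-- The sum `1 + 2 + ⋯ + k`. -/
def diagSum (k : ℕ) : ℕ := ∑ i : Fin k, ((i : ℕ) + 1)

/-- The Hermitian pencil with `x` times a traceless diagonal matrix, and `y` times the adjacency
matrix of the star centred at `none`. -/
def core (k : ℕ) (x y : ℂ) : Matrix (Option (Fin k)) (Option (Fin k)) ℂ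
  | none, none => -(diagSum k : ℂ) * x
  | none, some _ => y
  | some _, none => y
  | some i, some j => if i = j then ((i : ℂ) + 1) * x else 0

/-- The vector of `ℂ²` whose norm does not depend on `t` but whose dependence on `x, y` does. -/
noncomputable def rowVec (t x y : ℝ) : Fin 2 → ℂ :=
  ![x + Complex.I * t * y, √(1 - t ^ 2) * y]

/-- The skew-Hermitian pencil `x A(t) + y B(t)`. -/
noncomputable def pencil (k : ℕ) (t x y : ℝ) :
    Matrix (Fin 2 ⊕ Option (Fin k)) (Fin 2 ⊕ Option (Fin k)) ℂ :=
  Complex.I • fromBlocks 0 (coupling k (rowVec t x y))ᴴ (coupling k (rowVec t x y)) (core k x y)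

lemma core_conjTranspose (k : ℕ) (x y : ℝ) : (core k x y)ᴴ = core k x y := by
  ext (_ | i) (_ | j)
  · simp [core]
  · simp [core]
  · simp [core]
  · by_cases h : i = j
    · subst h; simp [core]
    · simp [core, h, Ne.symm h]

lemma trace_core (k : ℕ) (x y : ℝ) : (core k x y).trace = 0 := by
  simp [Matrix.trace, core, diagSum, Fintype.sum_option, Finset.sum_mul]

lemma pencil_conjTranspose (k : ℕ) (t x y : ℝ) : (pencil k t x y)ᴴ = -pencil k t x y := by
  simp [pencil, conjTranspose_smul, fromBlocks_conjTranspose, core_conjTranspose]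

lemma trace_fromBlocks {m n : Type*} [Fintype m] [Fintype n] (A : Matrix m m ℂ)
    (B : Matrix m n ℂ) (C : Matrix n m ℂ) (D : Matrix n n ℂ) :
    (fromBlocks A B C D).trace = A.trace + D.trace := by
  simp [Matrix.trace]

lemma trace_pencil (k : ℕ) (t x y : ℝ) : (pencil k t x y).trace = 0 := by
  simp [pencil, trace_fromBlocks, trace_core]

lemma pencil_add (k : ℕ) (t x y x' y' : ℝ) :
    pencil k t (x + x') (y + y') = pencil k t x y + pencil k t x' y' := by
  unfold pencil
  rw [← smul_add, fromBlocks_add]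
  congr 2
  · simp
  · ext c (_ | i) <;> fin_cases c <;> simp [coupling, rowVec] <;> ring
  · ext (_ | i) c <;> fin_cases c <;> simp [coupling, rowVec] <;> ring
  · ext (_ | i) (_ | j)
    on_goal 4 => by_cases h : i = j
    all_goals simp [core, *]
    all_goals ring

lemma pencil_smul (k : ℕ) (t r x y : ℝ) :
    pencil k t (r * x) (r * y) = r • pencil k t x y := by
  unfold pencil
  rw [smul_comm r Complex.I, fromBlocks_smul r]
  congr 2
  · simp
  · ext c (_ | i) <;> fin_cases c <;> simp [coupling, rowVec] <;> ring
  · ext (_ | i) c <;> fin_cases c <;> simp [coupling, rowVec] <;> ring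
  · ext (_ | i) (_ | j)
    on_goal 4 => by_cases h : i = j
    all_goals simp [core, *]
    all_goals ring

lemma continuous_pencil (k : ℕ) (x y : ℝ) : Continuous fun t => pencil k t x y := by
  have hw : Continuous fun t => coupling k (rowVec t x y) := by
    refine continuous_matrix fun i c => ?_
    rcases i with _ | i <;> fin_cases c <;> simp [coupling, rowVec] <;> fun_prop
  have h := Continuous.matrix_fromBlocks (continuous_const (y := (0 : Matrix (Fin 2) (Fin 2) ℂ)))
    hw.matrix_conjTranspose hw (continuous_const (y := core k x y))
  exact h.const_smul Complex.I

lemma normSq_rowVec {t : ℝ} (ht : t ∈ Set.Ioo (0 : ℝ) 1) (x y : ℝ) :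
    rowVec t x y ⬝ᵥ star (rowVec t x y) = x ^ 2 + y ^ 2 := by
  have h : ((√(1 - t ^ 2) : ℝ) : ℂ) ^ 2 = 1 - t ^ 2 := by
    rw [← Complex.ofReal_pow, Real.sq_sqrt (by nlinarith [ht.1, ht.2])]
    simp
  simp only [dotProduct, Fin.sum_univ_two, rowVec, Pi.star_apply, cons_val_zero, cons_val_one,
    RCLike.star_def, map_add, map_mul, Complex.conj_ofReal, Complex.conj_I]
  linear_combination (y : ℂ) ^ 2 * h - (t : ℂ) ^ 2 * (y : ℂ) ^ 2 * Complex.I_sq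

open scoped ComplexOrder in
/-- `SU(2)` acts transitively on spheres of `ℂ²`. -/
lemma exists_specialUnitary_vecMul_eq {w w' : Fin 2 → ℂ} (h : w ⬝ᵥ star w = w' ⬝ᵥ star w') :
    ∃ V ∈ specialUnitaryGroup (Fin 2) ℂ, w ᵥ* V = w' := by
  by_cases h0 : w ⬝ᵥ star w = 0
  · have h1 := h0
    rw [h] at h1
    rw [dotProduct_self_star_eq_zero] at h0 h1
    exact ⟨1, one_mem _, by simp [h0, h1]⟩
  set N := w ⬝ᵥ star w with hN
  have hNe : N = w 0 * star (w 0) + w 1 * star (w 1) := by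
    simp [hN, dotProduct, Fin.sum_univ_two]
  have hNe' : N = w' 0 * star (w' 0) + w' 1 * star (w' 1) := by
    simp [h, dotProduct, Fin.sum_univ_two]
  have hNs : star N = N := by rw [hNe]; simp; ring
  set p := (star (w 0) * w' 0 + w 1 * star (w' 1)) / N with hp
  set q := (star (w 0) * w' 1 - w 1 * star (w' 0)) / N with hq
  have hps : star p = (w 0 * star (w' 0) + star (w 1) * w' 1) / N := by
    rw [hp, star_div₀, hNs]; simp
  have hqs : star q = (w 0 * star (w' 1) - star (w 1) * w' 0) / N := by
    rw [hq, star_div₀, hNs]; simp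
  have hpq : p * star p + q * star q = 1 := by
    rw [hps, hqs, hp, hq]
    field_simp
    linear_combination (-N) * hNe -
      (w 0 * star (w 0) + w 1 * star (w 1)) * hNe'
  refine ⟨!![p, q; -star q, star p], ?_, ?_⟩
  · rw [mem_specialUnitaryGroup_iff, mem_unitaryGroup_iff]
    constructor
    · ext i j
      fin_cases i <;> fin_cases j <;> simp [mul_apply, star_apply, Fin.sum_univ_two] <;>
        (try simp only [← RCLike.star_def]) <;> first | linear_combination hpq | ring
    · rw [det_fin_two_of]; linear_combination hpq
  · ext i
    fin_cases i <;> simp only [vecMul, dotProduct, Fin.sum_univ_two] <;> simp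
    · simp only [RCLike.star_def] at hqs hNe
      rw [hqs, hp]
      field_simp
      simp only [RCLike.star_def]
      linear_combination (-w' 0) * hNe
    · simp only [RCLike.star_def] at hps hNe
      rw [hps, hq]
      field_simp
      simp only [RCLike.star_def]
      linear_combination (-w' 1) * hNe

lemma coupling_mul (k : ℕ) (w : Fin 2 → ℂ) (V : Matrix (Fin 2) (Fin 2) ℂ) :
    coupling k w * V = coupling k (w ᵥ* V) := by
  ext (_ | i) c <;> simp [coupling, mul_apply, vecMul, dotProduct]

lemma fromBlocks_mem_specialUnitaryGroup {m n : Type*} [Fintype m] [DecidableEq m] [Fintype n]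
    [DecidableEq n] {U : Matrix m m ℂ} (hU : U ∈ specialUnitaryGroup m ℂ) :
    fromBlocks U 0 0 (1 : Matrix n n ℂ) ∈ specialUnitaryGroup (m ⊕ n) ℂ := by
  rw [mem_specialUnitaryGroup_iff, mem_unitaryGroup_iff] at hU ⊢
  rw [star_eq_conjTranspose] at hU ⊢
  simp [fromBlocks_conjTranspose, fromBlocks_multiply, hU.1, hU.2]

lemma mul_inv_of_mem_specialUnitaryGroup {n : Type*} [Fintype n] [DecidableEq n]
    {A : Matrix n n ℂ} (hA : A ∈ specialUnitaryGroup n ℂ) : A * A⁻¹ = 1 := by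
  refine mul_nonsing_inv A ?_
  simp [(mem_specialUnitaryGroup_iff.1 hA).2]

lemma exists_pencil_eq_conj (k : ℕ) {s t : ℝ} (hs : s ∈ Set.Ioo (0 : ℝ) 1)
    (ht : t ∈ Set.Ioo (0 : ℝ) 1) (x y : ℝ) :
    ∃ A ∈ specialUnitaryGroup (Fin 2 ⊕ Option (Fin k)) ℂ,
      pencil k t x y * A = A * pencil k s x y := by
  obtain ⟨V, hV, h⟩ := exists_specialUnitary_vecMul_eq
    ((normSq_rowVec ht x y).trans (normSq_rowVec hs x y).symm)
  refine ⟨fromBlocks V 0 0 1, fromBlocks_mem_specialUnitaryGroup hV, ?_⟩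
  have hVV : V * Vᴴ = 1 := mem_unitaryGroup_iff.1 (mem_specialUnitaryGroup_iff.1 hV).1
  rw [pencil, pencil, ← h, ← coupling_mul]
  simp [fromBlocks_multiply, ← Matrix.mul_assoc, hVV]

lemma coupling_mul_conjTranspose (k : ℕ) (w : Fin 2 → ℂ) :
    coupling k w * (coupling k w)ᴴ = (w ⬝ᵥ star w) • single none none 1 := by
  ext (_ | i) (_ | j) <;> simp [coupling, mul_apply, dotProduct]

/-- The part of the invariant `tr (A² B²)` that does not depend on `t`. -/
noncomputable def invariantConst (k : ℕ) : ℂ :=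
  ((single none none 1 + core k 1 0 * core k 1 0) *
    (single none none 1 + core k 0 1 * core k 0 1)).trace

lemma trace_sq_mul_sq_pencil (k : ℕ) {t : ℝ} (ht : t ∈ Set.Ioo (0 : ℝ) 1) :
    (pencil k t 1 0 * pencil k t 1 0 * (pencil k t 0 1 * pencil k t 0 1)).trace =
      t ^ 2 + invariantConst k := by
  have hA := coupling_mul_conjTranspose k (rowVec t 1 0)
  have hB := coupling_mul_conjTranspose k (rowVec t 0 1)
  rw [normSq_rowVec ht] at hA hB
  have h₁ : ((coupling k (rowVec t 1 0))ᴴ * coupling k (rowVec t 1 0) *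
      ((coupling k (rowVec t 0 1))ᴴ * coupling k (rowVec t 0 1))).trace = (t : ℂ) ^ 2 := by
    simp [trace, mul_apply, Fin.sum_univ_two, Fintype.sum_option, coupling, rowVec]
    linear_combination - (t : ℂ) ^ 2 * Complex.I_sq
  have h₂ : ((coupling k (rowVec t 1 0))ᴴ * core k 1 0 *
      (core k 0 1 * coupling k (rowVec t 0 1))).trace = 0 := by
    simp [trace, mul_apply, Fintype.sum_option, coupling, rowVec, core]
  have h₃ : (core k 1 0 * coupling k (rowVec t 1 0) *
      ((coupling k (rowVec t 0 1))ᴴ * core k 0 1)).trace = 0 := by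
    simp [trace, mul_apply, Fin.sum_univ_two, Fintype.sum_option, coupling, rowVec, core]
  simp only [pencil, smul_mul_smul, fromBlocks_multiply, Complex.I_mul_I, invariantConst,
    trace_smul, trace_fromBlocks, trace_add, Complex.ofReal_one, Complex.ofReal_zero,
    Matrix.zero_mul, Matrix.mul_zero, zero_add, add_zero, hA, hB, h₁, h₂, h₃]
  simp

lemma eq_zero_of_commute_pencil (k : ℕ) {t : ℝ} (ht : t ∈ Set.Ioo (0 : ℝ) 1)
    {X : Matrix (Fin 2 ⊕ Option (Fin k)) (Fin 2 ⊕ Option (Fin k)) ℂ} (hX : X.trace = 0)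
    (hA : X * pencil k t 1 0 = pencil k t 1 0 * X)
    (hB : X * pencil k t 0 1 = pencil k t 0 1 * X) : X = 0 := by
  have hs : ((√(1 - t ^ 2) : ℝ) : ℂ) ≠ 0 := by
    rw [Complex.ofReal_ne_zero]
    exact (Real.sqrt_pos.2 (by nlinarith [ht.1, ht.2])).ne'
  have hd (i : Fin k) : ((i : ℂ) + 1) ≠ 0 := by exact Nat.cast_add_one_ne_zero _
  have hd' (i : Fin k) : ((i : ℂ) + 1) * (diagSum k + (i + 1)) - 1 ≠ 0 := by
    have h : (i : ℕ) + 1 ≤ diagSum k :=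
      Finset.single_le_sum (f := fun i : Fin k => (i : ℕ) + 1) (fun _ _ => Nat.zero_le _)
        (Finset.mem_univ i)
    have h' : ((i : ℕ) + 1) * (diagSum k + (i + 1)) ≠ 1 := by nlinarith
    exact sub_ne_zero.2 (by exact_mod_cast h')
  simp only [pencil, Matrix.mul_smul, Matrix.smul_mul] at hA hB
  replace hA := smul_right_injective _ Complex.I_ne_zero hA
  replace hB := smul_right_injective _ Complex.I_ne_zero hB
  have eA (p q) := congr_fun₂ hA p q
  have eB (p q) := congr_fun₂ hB p q
  clear hA hB
  simp only [mul_apply, Fintype.sum_sum_type, Fin.sum_univ_two, Fintype.sum_option] at eA eB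
  have a1 (i) := eA (.inr (some i)) (.inl 0)
  have a2 (i) := eA (.inr (some i)) (.inr none)
  have a3 (i) := eA (.inl 0) (.inr (some i))
  have a4 (i) := eA (.inr none) (.inr (some i))
  have a5 := eA (.inl 1) (.inl 0)
  have a6 := eA (.inl 1) (.inr none)
  have a7 := eA (.inl 0) (.inl 1)
  have a8 := eA (.inr none) (.inl 1)
  have a9 (i) := eA (.inr (some i)) (.inl 1)
  have a10 (i) := eA (.inl 1) (.inr (some i))
  have a11 (i j) := eA (.inr (some i)) (.inr (some j))
  have a12 := eA (.inr none) (.inl 0)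
  have a13 := eA (.inl 0) (.inl 0)
  have b1 := eB (.inr none) (.inl 1)
  have b2 := eB (.inl 0) (.inl 1)
  have b3 (i) := eB (.inr none) (.inr (some i))
  clear eA eB
  simp [coupling, rowVec, core] at a1 a2 a3 a4 a5 a6 a7 a8 a9 a10 a11 a12 a13 b1 b2 b3
  have zia (i) : X (.inr (some i)) (.inl 0) = 0 := by
    have h : X (.inr (some i)) (.inl 0) * (((i : ℂ) + 1) * (diagSum k + (i + 1)) - 1) = 0 := by
      linear_combination -(a2 i) - (diagSum k + ((i : ℂ) + 1)) * a1 i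
    exact (mul_eq_zero.1 h).resolve_right (hd' i)
  have zai (i) : X (.inl 0) (.inr (some i)) = 0 := by
    have h : X (.inl 0) (.inr (some i)) * (((i : ℂ) + 1) * (diagSum k + (i + 1)) - 1) = 0 := by
      linear_combination a4 i + (diagSum k + ((i : ℂ) + 1)) * a3 i
    exact (mul_eq_zero.1 h).resolve_right (hd' i)
  have zih (i) : X (.inr (some i)) (.inr none) = 0 := by rw [a1, zia, mul_zero]
  have zhi (i) : X (.inr none) (.inr (some i)) = 0 := by rw [← a3, zai, zero_mul]
  have zib (i) := (a9 i).resolve_left (hd i)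
  have zbi (i) := (a10 i).resolve_right (hd i)
  have zij (i j) (hij : i ≠ j) : X (.inr (some i)) (.inr (some j)) = 0 := by
    have h : X (.inr (some i)) (.inr (some j)) * ((j : ℂ) - i) = 0 := by
      linear_combination a11 i j
    refine (mul_eq_zero.1 h).resolve_right (sub_ne_zero.2 ?_)
    exact_mod_cast fun h : (j : ℕ) = i => hij (Fin.ext h.symm)
  have zhb := a7.symm
  have zab : X (.inl 0) (.inl 1) = 0 := by simpa [zhb] using a8.symm
  have zba : X (.inl 1) (.inl 0) = 0 := by simpa [a5] using a6
  have zah : X (.inl 0) (.inr none) = 0 := by simpa [zhb, hs] using b2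
  have zha : X (.inr none) (.inl 0) = 0 := a13 ▸ zah
  have daa : X (.inl 0) (.inl 0) = X (.inr none) (.inr none) := by simpa [zha] using a12.symm
  have dbb : X (.inl 1) (.inl 1) = X (.inr none) (.inr none) := by
    refine mul_left_cancel₀ hs ?_
    simpa [zab, zib, mul_comm] using b1.symm
  have dii (i) : X (.inr (some i)) (.inr (some i)) = X (.inr none) (.inr none) := by
    rw [b3 i, zai, zbi, Finset.sum_eq_single i (fun j _ hj => zij j i hj) (by simp)]
    ring
  have dhh : X (.inr none) (.inr none) = 0 := by
    have h : ((k : ℂ) + 3) * X (.inr none) (.inr none) = 0 := by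
      simp only [trace, diag, Fintype.sum_sum_type, Fin.sum_univ_two, Fintype.sum_option, daa, dbb,
        dii, Finset.sum_const, Finset.card_univ, Fintype.card_fin, nsmul_eq_mul] at hX
      linear_combination hX
    exact (mul_eq_zero.1 h).resolve_left (by exact_mod_cast (by simp : k + 3 ≠ 0))
  rw [dhh] at daa dbb dii
  ext (c | _ | i) (d | _ | j)
  on_goal 9 =>
    by_cases hij : i = j
    · exact hij ▸ dii i
    · exact zij i j hij
  all_goals try fin_cases c
  all_goals try fin_cases d
  all_goals simp [zia, zai, zih, zhi, zib, zbi, zhb, zab, zba, zah, zha, a5, daa, dbb, dhh]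

/-- `j(t)` in the standard basis, as a real-linear map. -/
noncomputable def linearPencil {k m : ℕ} (e : Fin 2 ⊕ Option (Fin k) ≃ Fin m) (t : ℝ) :
    (ℝ × ℝ) →ₗ[ℝ] Matrix (Fin m) (Fin m) ℂ where
  toFun Z := reindexAlgEquiv ℂ ℂ e (pencil k t Z.1 Z.2)
  map_add' Z Z' := by rw [← map_add, ← pencil_add]; rfl
  map_smul' r Z := by
    rw [Prod.smul_fst, Prod.smul_snd, smul_eq_mul, smul_eq_mul, pencil_smul]; rfl

lemma linearPencil_apply {k m : ℕ} (e : Fin 2 ⊕ Option (Fin k) ≃ Fin m) (t : ℝ) (Z : ℝ × ℝ) :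
    linearPencil e t Z = reindexAlgEquiv ℂ ℂ e (pencil k t Z.1 Z.2) := rfl

lemma trace_reindexAlgEquiv {n m : Type*} [Fintype n] [DecidableEq n] [Fintype m] [DecidableEq m]
    (e : n ≃ m) (M : Matrix n n ℂ) : (reindexAlgEquiv ℂ ℂ e M).trace = M.trace := by
  simp [trace, Equiv.sum_comp e.symm fun i => M i i]

lemma reindexAlgEquiv_mem_specialUnitaryGroup {n m : Type*} [Fintype n] [DecidableEq n]
    [Fintype m] [DecidableEq m] (e : n ≃ m) {A : Matrix n n ℂ}
    (hA : A ∈ specialUnitaryGroup n ℂ) :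
    reindexAlgEquiv ℂ ℂ e A ∈ specialUnitaryGroup m ℂ := by
  rw [mem_specialUnitaryGroup_iff, mem_unitaryGroup_iff] at hA ⊢
  refine ⟨?_, by rw [coe_reindexAlgEquiv, det_reindex_self, hA.2]⟩
  have h : star (reindexAlgEquiv ℂ ℂ e A) = reindexAlgEquiv ℂ ℂ e (star A) := by
    ext; simp [star_apply]
  rw [h, ← map_mul, hA.1, map_one]

lemma trace_sq_mul_sq_conj {n : Type*} [Fintype n] [DecidableEq n] {A P Q : Matrix n n ℂ}
    (hA : A ∈ specialUnitaryGroup n ℂ) :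
    (A * P * A⁻¹ * (A * P * A⁻¹) * (A * Q * A⁻¹ * (A * Q * A⁻¹))).trace =
      (P * P * (Q * Q)).trace := by
  have h : A⁻¹ * A = 1 := nonsing_inv_mul A (by simp [(mem_specialUnitaryGroup_iff.1 hA).2])
  have h' (M : Matrix n n ℂ) : A⁻¹ * (A * M) = M := by rw [← Matrix.mul_assoc, h, Matrix.one_mul]
  simp only [Matrix.mul_assoc, h']
  rw [trace_mul_comm]
  simp only [Matrix.mul_assoc, h, Matrix.mul_one]

lemma re_trace_sq_mul_sq_map_conj {n : Type*} [Fintype n] [DecidableEq n] (P Q : Matrix n n ℂ) :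
    (P.map (starRingEnd ℂ) * P.map (starRingEnd ℂ) *
      (Q.map (starRingEnd ℂ) * Q.map (starRingEnd ℂ))).trace.re = (P * P * (Q * Q)).trace.re := by
  have h (M N : Matrix n n ℂ) :
      M.map (starRingEnd ℂ) * N.map (starRingEnd ℂ) = (M * N).map (starRingEnd ℂ) :=
    Matrix.map_mul.symm
  rw [h, h, h]
  simp [trace, -Matrix.map_mul]

lemma trace_sq_mul_sq_signed_perm {n : Type*} [Fintype n]
    (f : (ℝ × ℝ) →ₗ[ℝ] Matrix n n ℂ) (Ψ : (ℝ × ℝ) ≃ₗ[ℝ] (ℝ × ℝ))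
    (h₁ : Ψ (1, 0) ∈ ({(1, 0), (-1, 0), (0, 1), (0, -1)} : Set (ℝ × ℝ)))
    (h₂ : Ψ (0, 1) ∈ ({(1, 0), (-1, 0), (0, 1), (0, -1)} : Set (ℝ × ℝ))) :
    (f (Ψ (1, 0)) * f (Ψ (1, 0)) * (f (Ψ (0, 1)) * f (Ψ (0, 1)))).trace =
      (f (1, 0) * f (1, 0) * (f (0, 1) * f (0, 1))).trace := by
  have n₁ : f (-1, 0) = -f (1, 0) := by rw [← map_neg]; simp
  have n₂ : f (0, -1) = -f (0, 1) := by rw [← map_neg]; simp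
  have i₁ : Ψ (1, 0) ≠ Ψ (0, 1) := fun h => by simpa using Ψ.injective h
  have i₂ : Ψ (1, 0) ≠ -Ψ (0, 1) := fun h => by
    rw [← map_neg] at h
    simpa using Ψ.injective h
  simp only [Set.mem_insert_iff, Set.mem_singleton_iff] at h₁ h₂
  rcases h₁ with h₁ | h₁ | h₁ | h₁ <;> rcases h₂ with h₂ | h₂ | h₂ | h₂ <;> rw [h₁, h₂] at i₁ i₂ ⊢ <;>
    first
    | (simp only [n₁, n₂, neg_mul_neg]; done)
    | (simp only [n₁, n₂, neg_mul_neg]; exact trace_mul_comm _ _)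
    | rfl
    | exact trace_mul_comm _ _
    | exact (i₁ rfl).elim
    | exact (i₂ (by simp)).elim

lemma trace_sq_mul_sq_linearPencil {k m : ℕ} (e : Fin 2 ⊕ Option (Fin k) ≃ Fin m) {t : ℝ}
    (ht : t ∈ Set.Ioo (0 : ℝ) 1) :
    (linearPencil e t (1, 0) * linearPencil e t (1, 0) *
      (linearPencil e t (0, 1) * linearPencil e t (0, 1))).trace = t ^ 2 + invariantConst k := by
  simp only [linearPencil_apply, ← map_mul, trace_reindexAlgEquiv]
  exact trace_sq_mul_sq_pencil k ht

end IsospectralPencil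

open IsospectralPencil

/-- Existence, for every `m ≥ 3`, of a nontrivial open interval `(a,b)` and a
continuous family of linear maps `ℝ² → su(m)` which are pairwise isospectral, pairwise
non-equivalent, and generic. -/
theorem exists_isospectral_family (m : ℕ) (hm : 3 ≤ m) :
    ∃ a b : ℝ, a < b ∧
    ∃ j : ℝ → (ℝ × ℝ) →ₗ[ℝ] Matrix (Fin m) (Fin m) ℂ,
      -- each j(t) takes values in su(m)
      (∀ t ∈ Set.Ioo a b, ∀ Z : ℝ × ℝ, (j t Z)ᴴ = -(j t Z) ∧ (j t Z).trace = 0) ∧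
      -- continuity of the family
      (∀ Z : ℝ × ℝ, ContinuousOn (fun t => j t Z) (Set.Ioo a b)) ∧
      -- (i) pairwise isospectral
      (∀ s ∈ Set.Ioo a b, ∀ t ∈ Set.Ioo a b, ∀ Z : ℝ × ℝ,
        ∃ A ∈ Matrix.specialUnitaryGroup (Fin m) ℂ, j t Z = A * j s Z * A⁻¹) ∧
      -- (ii) pairwise non-equivalent
      (∀ s ∈ Set.Ioo a b, ∀ t ∈ Set.Ioo a b, s ≠ t →
        ¬ ∃ (Ψ : (ℝ × ℝ) ≃ₗ[ℝ] (ℝ × ℝ)) (A : Matrix (Fin m) (Fin m) ℂ),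
            A ∈ Matrix.specialUnitaryGroup (Fin m) ℂ ∧
            Ψ (1, 0) ∈ ({(1, 0), (-1, 0), (0, 1), (0, -1)} : Set (ℝ × ℝ)) ∧
            Ψ (0, 1) ∈ ({(1, 0), (-1, 0), (0, 1), (0, -1)} : Set (ℝ × ℝ)) ∧
            ((∀ Z : ℝ × ℝ, j t Z = A * j s (Ψ Z) * A⁻¹) ∨
             (∀ Z : ℝ × ℝ, j t Z = A * (j s (Ψ Z)).map (starRingEnd ℂ) * A⁻¹))) ∧
      -- (iii) generic
      (∀ t ∈ Set.Ioo a b, ∀ X : Matrix (Fin m) (Fin m) ℂ,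
        Xᴴ = -X → X.trace = 0 →
        X * j t (1, 0) = j t (1, 0) * X → X * j t (0, 1) = j t (0, 1) * X → X = 0) := by
  obtain ⟨k, rfl⟩ := Nat.exists_eq_add_of_le hm
  let e : Fin 2 ⊕ Option (Fin k) ≃ Fin (3 + k) :=
    Fintype.equivFinOfCardEq (by simp; ring)
  refine ⟨0, 1, one_pos, linearPencil e, fun t _ Z => ⟨?_, ?_⟩, fun Z => ?_, ?_, ?_, ?_⟩
  · rw [linearPencil_apply, ← map_neg, ← pencil_conjTranspose]
    rfl
  · rw [linearPencil_apply, trace_reindexAlgEquiv, trace_pencil]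
  · exact ((continuous_pencil k Z.1 Z.2).matrix_submatrix e.symm e.symm).continuousOn
  · intro s hs t ht Z
    obtain ⟨A, hA, h⟩ := exists_pencil_eq_conj k hs ht Z.1 Z.2
    have hA' := reindexAlgEquiv_mem_specialUnitaryGroup e hA
    refine ⟨_, hA', ?_⟩
    rw [linearPencil_apply, linearPencil_apply, ← map_mul, ← h, map_mul, Matrix.mul_assoc,
      mul_inv_of_mem_specialUnitaryGroup hA', Matrix.mul_one]
  · rintro s hs t ht hst ⟨Ψ, A, hA, h₁, h₂, h⟩
    have key := congrArg Complex.re (trace_sq_mul_sq_linearPencil e ht)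
    have key' := congrArg Complex.re (trace_sq_mul_sq_linearPencil e hs)
    rw [← trace_sq_mul_sq_signed_perm _ Ψ h₁ h₂] at key'
    have hre : t ^ 2 = s ^ 2 := by
      rcases h with h | h
      · rw [h, h, trace_sq_mul_sq_conj hA, key'] at key
        simpa [← Complex.ofReal_pow] using key.symm
      · rw [h, h, trace_sq_mul_sq_conj hA, re_trace_sq_mul_sq_map_conj, key'] at key
        simpa [← Complex.ofReal_pow] using key.symm
    exact hst ((sq_eq_sq₀ hs.1.le ht.1.le).1 hre.symm)
  · intro t ht X _ hX hA hB
    have hX' : X = reindexAlgEquiv ℂ ℂ e ((reindexAlgEquiv ℂ ℂ e).symm X) := by simp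
    generalize (reindexAlgEquiv ℂ ℂ e).symm X = Y at hX'
    subst hX'
    simp only [linearPencil_apply, ← map_mul, EmbeddingLike.apply_eq_iff_eq,
      trace_reindexAlgEquiv] at hX hA hB
    rw [eq_zero_of_commute_pencil k ht hX hA hB, map_zero]
end

section
/- Let p, q be positive integers and n ≥ 2. Let (u, v₁, v₂) ∈ ℂ^{n−1}×ℂ×ℂ with ‖u‖² + |v₁|² + |v₂|² = 1, u ≠ 0, v₁ ≠ 0, v₂ ≠ 0. Set X₁ := (0, i·v₁, 0), X₂ := (0, 0, i·v₂) and w := (i·p·u, i·q·v₁, i·q·v₂). Then for j, k ∈ {1,2} the horizontal parts with respect to w satisfy ⟨X_jʰ, X_kʰ⟩ = δ_{jk}|v_j|² − q²|v_j|²|v_k|²/(p²‖u‖² + q²(|v₁|²+|v₂|²)), where δ_{jk} is the Kronecker delta. -/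
open Matrix

/-- The Hermitian inner product `⟪z,w⟫ = ∑ k, z k * conj (w k)` on `ℂᵐ`. -/
noncomputable def hinner {m : ℕ} (z w : Fin m → ℂ) : ℂ :=
  ∑ k, z k * (starRingEnd ℂ) (w k)

/-- The real inner product `⟨z,w⟩ = Re ⟪z,w⟫` on `ℂᵐ`. -/
noncomputable def rinner {m : ℕ} (z w : Fin m → ℂ) : ℝ := (hinner z w).re

/-- The squared norm `‖z‖² = ⟨z,z⟩` on `ℂᵐ`. -/
noncomputable def nsq {m : ℕ} (z : Fin m → ℂ) : ℝ := rinner z z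

/-- The 1-form `κ^j_u(U) = ‖u‖²⟨ju,U⟩ − ⟨U,iu⟩⟨ju,iu⟩` associated with a matrix `j`. -/
noncomputable def kappa {m : ℕ} (j : Matrix (Fin m) (Fin m) ℂ) (u U : Fin m → ℂ) : ℝ :=
  nsq u * rinner (j.mulVec u) U -
    rinner U (Complex.I • u) * rinner (j.mulVec u) (Complex.I • u)

/-- The space `ℂᵐ × ℂ × ℂ`. -/
abbrev E (m : ℕ) := (Fin m → ℂ) × ℂ × ℂ

/-- The real inner product `⟨z,w⟩ = Re(z·conj w)` on `ℂ`. -/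
noncomputable def rc (z w : ℂ) : ℝ := (z * (starRingEnd ℂ) w).re

/-- The real inner product on `ℂᵐ × ℂ × ℂ`. -/
noncomputable def ripE {m : ℕ} (x y : E m) : ℝ :=
  rinner x.1 y.1 + rc x.2.1 y.2.1 + rc x.2.2 y.2.2

/-- The horizontal part `Xʰ = X − (⟨X,w⟩/‖w‖²)·w` of `X` with respect to `w`. -/
noncomputable def hor {m : ℕ} (w X : E m) : E m :=
  X - (ripE X w / ripE w w) • w

theorem rinner_eq_sum {m : ℕ} (z w : Fin m → ℂ) : rinner z w = ∑ k, rc (z k) (w k) := by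
  simp [rinner, hinner, rc]

theorem rc_comm (z w : ℂ) : rc z w = rc w z := by
  simp [rc, mul_comm]

theorem rc_sub_left (x y z : ℂ) : rc (x - y) z = rc x z - rc y z := by
  simp [rc, sub_mul]

theorem rc_real_smul_left (c : ℝ) (x y : ℂ) : rc (c • x) y = c * rc x y := by
  simp [rc, mul_assoc]

theorem rc_mul_mul (c x y : ℂ) : rc (c * x) (c * y) = ‖c‖ ^ 2 * rc x y := by
  simp only [rc, Complex.sq_norm, Complex.normSq_apply, Complex.mul_re, Complex.mul_im,
    Complex.conj_re, Complex.conj_im]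
  ring

theorem rc_self (z : ℂ) : rc z z = ‖z‖ ^ 2 := by
  simp [rc, Complex.sq_norm, Complex.normSq_apply]

theorem ripE_comm {m : ℕ} (x y : E m) : ripE x y = ripE y x := by
  simp only [ripE, rinner_eq_sum, rc_comm]

theorem ripE_sub_left {m : ℕ} (x y z : E m) : ripE (x - y) z = ripE x z - ripE y z := by
  simp only [ripE, rinner_eq_sum, Prod.fst_sub, Prod.snd_sub, Pi.sub_apply, rc_sub_left,
    Finset.sum_sub_distrib]
  ring

theorem ripE_smul_left {m : ℕ} (c : ℝ) (x y : E m) : ripE (c • x) y = c * ripE x y := by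
  simp only [ripE, rinner_eq_sum, Prod.smul_fst, Prod.smul_snd, Pi.smul_apply,
    rc_real_smul_left, Finset.mul_sum, mul_add]

theorem ripE_sub_right {m : ℕ} (x y z : E m) : ripE x (y - z) = ripE x y - ripE x z := by
  rw [ripE_comm, ripE_sub_left, ripE_comm y, ripE_comm z]

theorem ripE_smul_right {m : ℕ} (c : ℝ) (x y : E m) : ripE x (c • y) = c * ripE x y := by
  rw [ripE_comm, ripE_smul_left, ripE_comm]

theorem ripE_hor_hor {m : ℕ} (w x y : E m) :
    ripE (hor w x) (hor w y) = ripE x y - ripE x w * ripE y w / ripE w w := by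
  simp only [hor, ripE_sub_left, ripE_sub_right, ripE_smul_left, ripE_smul_right, ripE_comm w y]
  by_cases h : ripE w w = 0
  · simp [h]
  · field_simp
    ring

theorem rinner_smul_smul {m : ℕ} (c : ℂ) (u : Fin m → ℂ) :
    rinner (c • u) (c • u) = ‖c‖ ^ 2 * nsq u := by
  simp only [nsq, rinner_eq_sum, Pi.smul_apply, smul_eq_mul, rc_mul_mul, Finset.mul_sum]

theorem rinner_zero_left {m : ℕ} (u : Fin m → ℂ) : rinner 0 u = 0 := by
  simp [rinner, hinner]

theorem rc_zero_left (z : ℂ) : rc 0 z = 0 := by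
  simp [rc]

theorem rc_I_mul_natCast_mul_I_mul (q : ℕ) (z : ℂ) :
    rc (Complex.I * z) ((q : ℂ) * Complex.I * z) = q * ‖z‖ ^ 2 := by
  rw [rc_comm, mul_assoc, ← Complex.ofReal_natCast, ← Complex.real_smul, rc_real_smul_left,
    rc_self]
  simp

/-- Corollary 4.12 of the paper, the Gram matrix of the horizontal parts of the
fundamental vectors `X₁ = (0, iv₁, 0)`, `X₂ = (0, 0, iv₂)` of the torus action with respect to
the vertical direction `w = (ipu, iqv₁, iqv₂)` of the weighted circle action. -/
theorem horizontal_gram (p q n : ℕ) (hp : 0 < p) (hq : 0 < q) (hn : 2 ≤ n)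
    (u : Fin (n - 1) → ℂ) (v : Fin 2 → ℂ)
    (hsphere : nsq u + ‖v 0‖ ^ 2 + ‖v 1‖ ^ 2 = 1)
    (hu : u ≠ 0) (hv₁ : v 0 ≠ 0) (hv₂ : v 1 ≠ 0)
    (X : Fin 2 → E (n - 1)) (w : E (n - 1))
    (hX0 : X 0 = (0, Complex.I * v 0, 0)) (hX1 : X 1 = (0, 0, Complex.I * v 1))
    (hw : w = (((p : ℂ) * Complex.I) • u, (q : ℂ) * Complex.I * v 0, (q : ℂ) * Complex.I * v 1)) :
    ∀ j k : Fin 2,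
      ripE (hor w (X j)) (hor w (X k)) =
        (if j = k then ‖v j‖ ^ 2 else 0) -
          (q : ℝ) ^ 2 * ‖v j‖ ^ 2 * ‖v k‖ ^ 2 /
            ((p : ℝ) ^ 2 * nsq u + (q : ℝ) ^ 2 * (‖v 0‖ ^ 2 + ‖v 1‖ ^ 2)) := by
  have hww : ripE w w =
      (p : ℝ) ^ 2 * nsq u + (q : ℝ) ^ 2 * (‖v 0‖ ^ 2 + ‖v 1‖ ^ 2) := by
    simp only [hw, ripE, rinner_smul_smul, rc_self, norm_mul, Complex.norm_natCast,
      Complex.norm_I]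
    ring
  have hXw (j : Fin 2) : ripE (X j) w = q * ‖v j‖ ^ 2 := by
    fin_cases j <;>
      simp [hX0, hX1, hw, ripE, rinner_zero_left, rc_zero_left, rc_I_mul_natCast_mul_I_mul]
  have hXX (j k : Fin 2) : ripE (X j) (X k) = if j = k then ‖v j‖ ^ 2 else 0 := by
    fin_cases j <;> fin_cases k <;>
      simp [hX0, hX1, ripE, rinner_zero_left, rc_zero_left, rc_comm _ 0, rc_self]
  intro j k
  rw [ripE_hor_hor, hww, hXw, hXw, hXX]
  ring
end

section
/- Let m ≥ 1, a ∈ (0, 1/√2), and let j be a skew-Hermitian complex m×m matrix (jᴴ = −j). For W ∈ ℂ^m define f_W : ℂ^m → ℝ by f_W(u) := ‖u‖²·⟨j u, W⟩ − ⟨W, i·u⟩·⟨j u, i·u⟩. Let u ∈ ℂ^m with ‖u‖² = 1 − 2a², and let U₁, U₂ ∈ ℂ^m with ⟨U₁, u⟩ = ⟨U₂, u⟩ = 0. Then D_{U₁} f_{U₂}(u) − D_{U₂} f_{U₁}(u) = 2(1−2a²)·⟨j U₁ʰ, U₂ʰ⟩ − 2·⟨j u, i·u⟩·⟨i·U₁,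 U₂⟩, where Uʰ := U − (⟨U, i·u⟩/(1−2a²))·i·u and D_X g(u) denotes the directional (Fréchet) derivative of g at u in the direction X. -/
open Matrix

/-- `f_W(u) = ‖u‖²⟨ju,W⟩ − ⟨W,iu⟩⟨ju,iu⟩`, as a function of `u`. -/
noncomputable def fW {m : ℕ} (j : Matrix (Fin m) (Fin m) ℂ) (W : Fin m → ℂ)
    (u : Fin m → ℂ) : ℝ :=
  nsq u * rinner (j.mulVec u) W -
    rinner W (Complex.I • u) * rinner (j.mulVec u) (Complex.I • u)

theorem rinner_comm {m : ℕ} (z w : Fin m → ℂ) : rinner z w = rinner w z := by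
  simp only [rinner, hinner, Complex.re_sum]
  refine Finset.sum_congr rfl fun k _ => ?_
  simp only [Complex.mul_re, Complex.conj_re, Complex.conj_im]
  ring

theorem rinner_add_left {m : ℕ} (x y z : Fin m → ℂ) :
    rinner (x + y) z = rinner x z + rinner y z := by
  simp [rinner, hinner, add_mul, Finset.sum_add_distrib]

theorem rinner_smul_left {m : ℕ} (c : ℝ) (x z : Fin m → ℂ) :
    rinner (c • x) z = c * rinner x z := by
  simp [rinner, hinner, Finset.mul_sum, mul_assoc]

theorem rinner_add_right {m : ℕ} (x y z : Fin m → ℂ) :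
    rinner x (y + z) = rinner x y + rinner x z := by
  rw [rinner_comm, rinner_add_left, rinner_comm y, rinner_comm z]

theorem rinner_smul_right {m : ℕ} (c : ℝ) (x z : Fin m → ℂ) :
    rinner x (c • z) = c * rinner x z := by
  rw [rinner_comm, rinner_smul_left, rinner_comm z]

theorem rinner_sub_left {m : ℕ} (x y z : Fin m → ℂ) :
    rinner (x - y) z = rinner x z - rinner y z := by
  simp [rinner, hinner, sub_mul, Finset.sum_sub_distrib]

theorem rinner_sub_right {m : ℕ} (x y z : Fin m → ℂ) :
    rinner x (y - z) = rinner x y - rinner x z := by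
  rw [rinner_comm, rinner_sub_left, rinner_comm y, rinner_comm z]

theorem rinner_I_smul_left {m : ℕ} (x y : Fin m → ℂ) :
    rinner (Complex.I • x) y = -rinner x (Complex.I • y) := by
  simp only [rinner, hinner, Complex.re_sum, ← Finset.sum_neg_distrib]
  refine Finset.sum_congr rfl fun k _ => ?_
  simp
  ring

theorem hinner_eq_dotProduct {m : ℕ} (x y : Fin m → ℂ) : hinner x y = x ⬝ᵥ star y := rfl

/-- A skew-Hermitian matrix is skew-adjoint for the real inner product. -/
theorem rinner_mulVec_left {m : ℕ} {j : Matrix (Fin m) (Fin m) ℂ} (hj : jᴴ = -j)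
    (x y : Fin m → ℂ) : rinner (j.mulVec x) y = -rinner x (j.mulVec y) := by
  have h : star (j.mulVec y) = -(star y ᵥ* j) := by
    rw [star_mulVec, hj, vecMul_neg]
  rw [rinner, rinner, hinner_eq_dotProduct, hinner_eq_dotProduct, h, dotProduct_neg,
    Complex.neg_re, neg_neg, dotProduct_comm, dotProduct_mulVec, dotProduct_comm]

/-- The derivative of the real inner product of two real-linear functions. -/
theorem hasFDerivAt_rinner {m : ℕ} (A B : (Fin m → ℂ) →ₗ[ℝ] (Fin m → ℂ)) (u : Fin m → ℂ) :
    ∃ L : (Fin m → ℂ) →L[ℝ] ℝ, HasFDerivAt (fun v => rinner (A v) (B v)) L u ∧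
      ∀ X, L X = rinner (A u) (B X) + rinner (A X) (B u) := by
  let b : (Fin m → ℂ) →L[ℝ] (Fin m → ℂ) →L[ℝ] ℝ :=
    (LinearMap.mk₂ ℝ rinner rinner_add_left rinner_smul_left rinner_add_right
      rinner_smul_right).toContinuousBilinearMap
  exact ⟨_, b.hasFDerivAt_of_bilinear (LinearMap.toContinuousLinearMap A).hasFDerivAt
    (LinearMap.toContinuousLinearMap B).hasFDerivAt, fun X => rfl⟩

/-- The derivative of the real inner product of a real-linear function with a constant. -/
theorem hasFDerivAt_rinner_const {m : ℕ} (A : (Fin m → ℂ) →ₗ[ℝ] (Fin m → ℂ))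
    (W u : Fin m → ℂ) :
    ∃ L : (Fin m → ℂ) →L[ℝ] ℝ, HasFDerivAt (fun v => rinner (A v) W) L u ∧
      ∀ X, L X = rinner (A X) W := by
  let l : (Fin m → ℂ) →ₗ[ℝ] ℝ :=
    { toFun := fun v => rinner (A v) W
      map_add' := fun x y => by rw [map_add, rinner_add_left]
      map_smul' := fun c x => by rw [map_smul, rinner_smul_left]; rfl }
  exact ⟨_, (LinearMap.toContinuousLinearMap l).hasFDerivAt, fun X => rfl⟩

theorem fderiv_fW {m : ℕ} (j : Matrix (Fin m) (Fin m) ℂ) (W u X : Fin m → ℂ) :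
    fderiv ℝ (fW j W) u X =
      2 * rinner X u * rinner (j.mulVec u) W + nsq u * rinner (j.mulVec X) W -
        rinner W (Complex.I • X) * rinner (j.mulVec u) (Complex.I • u) -
        rinner W (Complex.I • u) *
          (rinner (j.mulVec X) (Complex.I • u) + rinner (j.mulVec u) (Complex.I • X)) := by
  let J : (Fin m → ℂ) →ₗ[ℝ] (Fin m → ℂ) := j.mulVecLin.restrictScalars ℝ
  let K : (Fin m → ℂ) →ₗ[ℝ] (Fin m → ℂ) :=
    (Complex.I • (LinearMap.id : (Fin m → ℂ) →ₗ[ℂ] (Fin m → ℂ))).restrictScalars ℝ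
  obtain ⟨L₁, h₁, e₁⟩ := hasFDerivAt_rinner LinearMap.id LinearMap.id u
  obtain ⟨L₂, h₂, e₂⟩ := hasFDerivAt_rinner_const J W u
  obtain ⟨L₃, h₃, e₃⟩ := hasFDerivAt_rinner_const K W u
  obtain ⟨L₄, h₄, e₄⟩ := hasFDerivAt_rinner J K u
  have hf : fW j W = fun v => rinner v v * rinner (J v) W - rinner (K v) W * rinner (J v) (K v) := by
    funext v
    rw [rinner_comm (K v) W]
    rfl
  have hJ : ∀ v, J v = j.mulVec v := fun _ => rfl
  have hK : ∀ v, K v = Complex.I • v := fun _ => rfl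
  have h := (h₁.mul h₂).sub (h₃.mul h₄)
  rw [hf]
  refine (congrArg (fun L : (Fin m → ℂ) →L[ℝ] ℝ => L X) h.fderiv).trans ?_
  simp only [_root_.sub_apply, _root_.add_apply,
    _root_.smul_apply, smul_eq_mul, e₁, e₂, e₃, e₄, LinearMap.id_apply, hJ, hK, nsq]
  rw [rinner_comm u X, rinner_comm (Complex.I • u) W, rinner_comm (Complex.I • X) W]
  ring

/-- equation (4.7) of the paper: for `u` on the sphere of radius `√(1−2a²)` and
tangent vectors `U₁, U₂`, the antisymmetrized directional derivative
`D_{U₁}f_{U₂}(u) − D_{U₂}f_{U₁}(u)` equals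
`2(1−2a²)⟨jU₁ʰ,U₂ʰ⟩ − 2⟨ju,iu⟩⟨iU₁,U₂⟩`. -/
theorem dkappa_formula (m : ℕ) (hm : 1 ≤ m) (a : ℝ) (ha : a ∈ Set.Ioo 0 (1 / Real.sqrt 2))
    (j : Matrix (Fin m) (Fin m) ℂ) (hj : jᴴ = -j)
    (u U₁ U₂ : Fin m → ℂ) (hu : nsq u = 1 - 2 * a ^ 2)
    (hU₁ : rinner U₁ u = 0) (hU₂ : rinner U₂ u = 0) :
    fderiv ℝ (fW j U₂) u U₁ - fderiv ℝ (fW j U₁) u U₂ =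
      2 * (1 - 2 * a ^ 2) *
          rinner (j.mulVec
              (U₁ - (rinner U₁ (Complex.I • u) / (1 - 2 * a ^ 2)) • (Complex.I • u)))
            (U₂ - (rinner U₂ (Complex.I • u) / (1 - 2 * a ^ 2)) • (Complex.I • u)) -
        2 * rinner (j.mulVec u) (Complex.I • u) * rinner (Complex.I • U₁) U₂ := by
  have hR : 1 - 2 * a ^ 2 ≠ 0 := by
    have h2 : a * Real.sqrt 2 < 1 := (lt_div_iff₀ (by positivity)).1 ha.2
    have h3 : Real.sqrt 2 ^ 2 = 2 := Real.sq_sqrt (by norm_num)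
    have h4 : 0 < a * Real.sqrt 2 := mul_pos ha.1 (by positivity)
    have h5 : (a * Real.sqrt 2) ^ 2 = 2 * a ^ 2 := by rw [mul_pow, h3, mul_comm]
    nlinarith
  have hswap : ∀ X, rinner (j.mulVec u) (Complex.I • X) = rinner (j.mulVec X) (Complex.I • u) := by
    intro X
    rw [rinner_mulVec_left hj, mulVec_smul, ← rinner_I_smul_left, rinner_comm]
  have hskew : rinner (j.mulVec (Complex.I • u)) (Complex.I • u) = 0 := by
    have h := rinner_mulVec_left hj (Complex.I • u) (Complex.I • u)
    rw [rinner_comm (Complex.I • u) (j.mulVec _)] at h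
    linarith
  have h21 : rinner (j.mulVec U₂) U₁ = -rinner (j.mulVec U₁) U₂ := by
    rw [rinner_mulVec_left hj, rinner_comm]
  have hu2 : rinner (j.mulVec (Complex.I • u)) U₂ = -rinner (j.mulVec U₂) (Complex.I • u) := by
    rw [rinner_mulVec_left hj, rinner_comm]
  have hI : rinner U₁ (Complex.I • U₂) = -rinner (Complex.I • U₁) U₂ := by
    rw [rinner_I_smul_left, neg_neg]
  rw [fderiv_fW, fderiv_fW, hU₁, hU₂, hu, hswap U₁, hswap U₂, h21, hI,
    rinner_comm U₂ (Complex.I • U₁), mulVec_sub, mulVec_smul]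
  simp only [rinner_sub_left, rinner_sub_right, rinner_smul_left, rinner_smul_right, hskew, hu2]
  field_simp
  ring
end

section
/- Let m ≥ 3 and a ∈ (0, 1/√2). Let τ be a complex m×m matrix with τᴴ = −τ and trace(τ) = 0. Suppose that for every u ∈ ℂ^m with ‖u‖² = 1 − 2a² and all U₁, U₂ ∈ ℂ^m with ⟨U₁, u⟩ = ⟨U₂, u⟩ = 0 one has 0 = (1−2a²)·⟨τ U₁ʰ, U₂ʰ⟩ − ⟨τ u, i·u⟩·⟨i·U₁, U₂⟩, where Uʰ := U − (⟨U, i·u⟩/(1−2a²))·i·u. Then τ = 0. -/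
open Matrix

theorem hinner_single_right {m : ℕ} (z : Fin m → ℂ) (k : Fin m) (x : ℂ) :
    hinner z (Pi.single k x) = z k * (starRingEnd ℂ) x := by
  unfold hinner
  rw [Finset.sum_eq_single k] <;> simp +contextual

/-- A vector supported at `l ≠ k` is Hermitian-orthogonal to one supported at `k`. -/
theorem rinner_single_single_of_ne {m : ℕ} {k l : Fin m} (hlk : l ≠ k) (x y : ℂ) :
    rinner (Pi.single l x) (Pi.single k y) = 0 := by
  rw [rinner, hinner_single_right, Pi.single_eq_of_ne hlk.symm, zero_mul, Complex.zero_re]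

theorem rinner_mulVec_single_single {m : ℕ} (τ : Matrix (Fin m) (Fin m) ℂ) (l p : Fin m)
    (x y : ℂ) :
    rinner (τ.mulVec (Pi.single l x)) (Pi.single p y) =
      (τ p l * x * (starRingEnd ℂ) y).re := by
  simp [rinner, hinner_single_right, Matrix.mulVec_single]
  ring

/-- the linear-algebra step in the non-isometry proof: a traceless
skew-Hermitian matrix `τ` satisfying
`0 = (1−2a²)⟨τU₁ʰ,U₂ʰ⟩ − ⟨τu,iu⟩⟨iU₁,U₂⟩` for all `u` with `‖u‖² = 1−2a²` and all tangent
vectors `U₁, U₂` must vanish. -/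
theorem tau_eq_zero (m : ℕ) (hm : 3 ≤ m) (a : ℝ) (ha : a ∈ Set.Ioo 0 (1 / Real.sqrt 2))
    (τ : Matrix (Fin m) (Fin m) ℂ) (hτ : τᴴ = -τ) (htr : τ.trace = 0)
    (h : ∀ u : Fin m → ℂ, nsq u = 1 - 2 * a ^ 2 →
      ∀ U₁ U₂ : Fin m → ℂ, rinner U₁ u = 0 → rinner U₂ u = 0 →
        0 = (1 - 2 * a ^ 2) *
              rinner (τ.mulVec
                  (U₁ - (rinner U₁ (Complex.I • u) / (1 - 2 * a ^ 2)) • (Complex.I • u)))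
                (U₂ - (rinner U₂ (Complex.I • u) / (1 - 2 * a ^ 2)) • (Complex.I • u)) -
            rinner (τ.mulVec u) (Complex.I • u) * rinner (Complex.I • U₁) U₂) :
    τ = 0 := by
  have hc : 0 < 1 - 2 * a ^ 2 := by
    obtain ⟨h0, h1⟩ := ha
    have h2 : a ^ 2 < (1 / Real.sqrt 2) ^ 2 := pow_lt_pow_left₀ h1 h0.le two_ne_zero
    rw [div_pow, Real.sq_sqrt zero_le_two] at h2
    linarith
  generalize 1 - 2 * a ^ 2 = c at h hc
  have hsq : Real.sqrt c * Real.sqrt c = c := Real.mul_self_sqrt hc.le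
  have key : ∀ k l p : Fin m, l ≠ k → p ≠ k → ∀ x y : ℂ,
      (τ p l * x * (starRingEnd ℂ) y).re =
        (τ k k).im * rinner (Pi.single l (Complex.I * x)) (Pi.single p y) := by
    intro k l p hl hp x y
    have hu : nsq (Pi.single k (Real.sqrt c : ℂ) : Fin m → ℂ) = c := by
      simp [nsq, rinner, hinner_single_right, hsq]
    have h1 := h _ hu (Pi.single l x) (Pi.single p y) (rinner_single_single_of_ne hl _ _)
      (rinner_single_single_of_ne hp _ _)
    simp only [← Pi.single_smul, smul_eq_mul, rinner_single_single_of_ne hl,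
      rinner_single_single_of_ne hp, zero_div, zero_smul, sub_zero,
      rinner_mulVec_single_single] at h1
    have h2 : (τ k k * (Real.sqrt c : ℂ) *
        (starRingEnd ℂ) (Complex.I * (Real.sqrt c : ℂ))).re = c * (τ k k).im := by
      simp
      linear_combination (τ k k).im * hsq
    rw [h2] at h1
    apply mul_left_cancel₀ hc.ne'
    linear_combination -h1
  have hre : ∀ k, (τ k k).re = 0 := by
    intro k
    have h1 := congrArg Complex.re (congrFun (congrFun hτ k) k)
    simp at h1
    linarith
  have him : ∀ k l, (τ l l).im = (τ k k).im := by
    intro k l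
    rcases eq_or_ne l k with rfl | hl
    · rfl
    · have h1 := key k l l hl hl 1 Complex.I
      simpa [rinner, hinner_single_right] using h1
  have hdiag : ∀ k, (τ k k).im = 0 := by
    intro k
    have h1 := congrArg Complex.im htr
    simp only [Matrix.trace, Matrix.diag_apply, Complex.im_sum, him k, Finset.sum_const,
      Finset.card_univ, Fintype.card_fin, nsmul_eq_mul, Complex.zero_im] at h1
    exact (mul_eq_zero.mp h1).resolve_left (by positivity)
  ext p l
  rcases eq_or_ne p l with rfl | hpl
  · exact Complex.ext (hre p) (hdiag p)
  · obtain ⟨k, hk⟩ : ∃ k, k ∉ ({p, l} : Finset (Fin m)) := by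
      by_contra! hall
      have h1 : Fintype.card (Fin m) ≤ 2 :=
        (Finset.card_le_card fun k _ => hall k).trans Finset.card_le_two
      rw [Fintype.card_fin] at h1
      omega
    simp only [Finset.mem_insert, Finset.mem_singleton, not_or] at hk
    have h1 := key k l p (Ne.symm hk.2) (Ne.symm hk.1) 1 1
    have h2 := key k l p (Ne.symm hk.2) (Ne.symm hk.1) 1 Complex.I
    rw [hdiag k, zero_mul] at h1 h2
    exact Complex.ext (by simpa using h1) (by simpa using h2)
end
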